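/- Let S be a simple projective A-module and let P_1, P_0 be finite-dimensional projective A-modules. Let h = (f,g) : P_1 ⊕ S → P_0 be a homomorphism with components f : P_1 → P_0 and g : S → P_0, and suppose rank(h) = r(P_1,P_0) + dim_K(S). Then rank(f) = r(P_1,P_0), g is injective, Im(f) ∩ Im(g) = 0, and there is a short exact sequence 0 → S → Coker(f) → Coker(h) → 0 of A-modules. -/

import Mathlib

/-- The rank of an `A`-linear map between modules over a `K`-algebra `A`:
the `K`-dimension of its image. -/
noncomputable def rk (K : Type*) [Field K] {A : Type*} [Ring A] [Algebra K A]
    {M N : Type*} [AddCommGroup M] [Module A M]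
    [AddCommGroup N] [Module A N] [Module K N] [IsScalarTower K A N]
    (f : M →ₗ[A] N) : ℕ :=
  Module.finrank K ((LinearMap.range f).restrictScalars K)

/-- `rmax K A M N` is `r(M,N)`, the maximal rank of an `A`-linear map `M → N`. -/
noncomputable def rmax (K : Type*) [Field K] (A : Type*) [Ring A] [Algebra K A]
    (M N : Type*) [AddCommGroup M] [Module A M]
    [AddCommGroup N] [Module A N] [Module K N] [IsScalarTower K A N] : ℕ :=
  sSup {n : ℕ | ∃ f : M →ₗ[A] N, rk K f = n}

theorem rk_le_rmax {K A : Type*} [Field K] [Ring A] [Algebra K A]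
    {M N : Type*} [AddCommGroup M] [Module A M]
    [AddCommGroup N] [Module A N] [Module K N] [IsScalarTower K A N] [FiniteDimensional K N]
    (f : M →ₗ[A] N) : rk K f ≤ rmax K A M N := by
  refine le_csSup ⟨Module.finrank K N, ?_⟩ ⟨f, rfl⟩
  rintro _ ⟨f', rfl⟩
  exact Submodule.finrank_le _

theorem rk_le_finrank_domain {K A : Type*} [Field K] [Ring A] [Algebra K A]
    {M N : Type*} [AddCommGroup M] [Module A M] [Module K M] [IsScalarTower K A M]
    [FiniteDimensional K M]
    [AddCommGroup N] [Module A N] [Module K N] [IsScalarTower K A N]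
    (f : M →ₗ[A] N) : rk K f ≤ Module.finrank K M :=
  LinearMap.finrank_range_le (f.restrictScalars K)

theorem injective_of_rk_eq_finrank {K A : Type*} [Field K] [Ring A] [Algebra K A]
    {M N : Type*} [AddCommGroup M] [Module A M] [Module K M] [IsScalarTower K A M]
    [FiniteDimensional K M]
    [AddCommGroup N] [Module A N] [Module K N] [IsScalarTower K A N]
    (f : M →ₗ[A] N) (h : rk K f = Module.finrank K M) : Function.Injective f := by
  have hadd := LinearMap.finrank_range_add_finrank_ker (f.restrictScalars K)
  have hr : Module.finrank K (LinearMap.range (f.restrictScalars K)) = Module.finrank K M := h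
  have hker : LinearMap.ker (f.restrictScalars K) = ⊥ :=
    Submodule.finrank_eq_zero.mp (by omega)
  exact (LinearMap.ker_eq_bot (f := f.restrictScalars K)).mp hker

theorem rk_coprod_add_finrank_inf {K A : Type*} [Field K] [Ring A] [Algebra K A]
    {M M' N : Type*} [AddCommGroup M] [Module A M] [AddCommGroup M'] [Module A M']
    [AddCommGroup N] [Module A N] [Module K N] [IsScalarTower K A N] [FiniteDimensional K N]
    (f : M →ₗ[A] N) (g : M' →ₗ[A] N) :
    rk K (LinearMap.coprod f g) +
      Module.finrank K ((LinearMap.range f ⊓ LinearMap.range g).restrictScalars K) =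
    rk K f + rk K g := by
  have h := Submodule.finrank_sup_add_finrank_inf_eq
    ((LinearMap.range f).restrictScalars K) ((LinearMap.range g).restrictScalars K)
  rw [← Submodule.restrictScalars_sup, ← Submodule.restrictScalars_inf,
    ← LinearMap.range_coprod] at h
  exact h

/-- If the images of `f` and `g` are independent and `g` is injective, the cokernels of `f` and
of `(f, g)` fit into a short exact sequence. -/
theorem exists_exact_quotient_range_coprod {A M M' N : Type*} [Ring A]
    [AddCommGroup M] [Module A M] [AddCommGroup M'] [Module A M'] [AddCommGroup N] [Module A N]
    (f : M →ₗ[A] N) (g : M' →ₗ[A] N) (hg : Function.Injective g)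
    (hfg : LinearMap.range f ⊓ LinearMap.range g = ⊥) :
    ∃ (α : M' →ₗ[A] (N ⧸ LinearMap.range f))
      (β : (N ⧸ LinearMap.range f) →ₗ[A] (N ⧸ LinearMap.range (LinearMap.coprod f g))),
      Function.Injective α ∧ Function.Surjective β ∧
      LinearMap.range α = LinearMap.ker β := by
  have hle : LinearMap.range f ≤ LinearMap.range (LinearMap.coprod f g) := by
    rw [LinearMap.range_coprod]
    exact le_sup_left
  refine ⟨(LinearMap.range f).mkQ ∘ₗ g, Submodule.factor hle, ?_,
    Submodule.factor_surjective hle, ?_⟩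
  · rw [injective_iff_map_eq_zero]
    intro x hx
    have hx' : g x ∈ LinearMap.range f := by simpa using hx
    have hmem : g x ∈ LinearMap.range f ⊓ LinearMap.range g := ⟨hx', x, rfl⟩
    rw [hfg, Submodule.mem_bot] at hmem
    exact hg (hmem.trans (map_zero g).symm)
  · ext y
    obtain ⟨y, rfl⟩ := Submodule.mkQ_surjective _ y
    have hker : (LinearMap.range f).mkQ y ∈ LinearMap.ker (Submodule.factor hle) ↔
        y ∈ LinearMap.range (LinearMap.coprod f g) := by
      simp [LinearMap.mem_ker, -LinearMap.mem_range]
    rw [hker]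
    constructor
    · rintro ⟨x, hx⟩
      obtain ⟨p, hp⟩ := (Submodule.Quotient.eq _).mp hx.symm
      exact ⟨(p, x), by simp [hp]⟩
    · rintro ⟨⟨p, x⟩, rfl⟩
      refine ⟨x, ((Submodule.Quotient.eq (LinearMap.range f)).mpr ⟨p, ?_⟩).symm⟩
      simp

theorem stmt8 {K A : Type*} [Field K] [IsAlgClosed K] [Ring A] [Algebra K A]
    [FiniteDimensional K A]
    {S : Type*} [AddCommGroup S] [Module A S] [Module K S] [IsScalarTower K A S]
    [FiniteDimensional K S]
    (hSsimple : IsSimpleModule A S) (hSproj : Module.Projective A S)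
    {P₁ P₀ : Type*}
    [AddCommGroup P₁] [Module A P₁] [Module K P₁] [IsScalarTower K A P₁] [FiniteDimensional K P₁]
    [AddCommGroup P₀] [Module A P₀] [Module K P₀] [IsScalarTower K A P₀] [FiniteDimensional K P₀]
    (hP₁proj : Module.Projective A P₁) (hP₀proj : Module.Projective A P₀)
    (f : P₁ →ₗ[A] P₀) (g : S →ₗ[A] P₀)
    (hrank : rk K (LinearMap.coprod f g) = rmax K A P₁ P₀ + Module.finrank K S) :
    rk K f = rmax K A P₁ P₀ ∧
    Function.Injective g ∧
    LinearMap.range f ⊓ LinearMap.range g = ⊥ ∧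
    ∃ (α : S →ₗ[A] (P₀ ⧸ LinearMap.range f))
      (β : (P₀ ⧸ LinearMap.range f) →ₗ[A] (P₀ ⧸ LinearMap.range (LinearMap.coprod f g))),
      Function.Injective α ∧ Function.Surjective β ∧
      LinearMap.range α = LinearMap.ker β := by
  have hf := rk_le_rmax (K := K) f
  have hg := rk_le_finrank_domain (K := K) g
  have hsum := rk_coprod_add_finrank_inf (K := K) f g
  have hinj : Function.Injective g := injective_of_rk_eq_finrank (K := K) g (by omega)
  have hbot : LinearMap.range f ⊓ LinearMap.range g = ⊥ := by
    rw [← Submodule.restrictScalars_eq_bot_iff (S := K)]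
    exact Submodule.finrank_eq_zero.mp (by omega)
  exact ⟨by omega, hinj, hbot, exists_exact_quotient_range_coprod f g hinj hbot⟩
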